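/- Fix an integer d ≥ 2 and reals m > 0 and z > 0. Then the Lebesgue integral over ℝ^d of the function p ↦ exp(−(z/m)·√(m² + ‖p‖²)) equals 2m·(2π m²/z)^{(d−1)/2} · K_{(d+1)/2}(z). (This is the particle density n of the Jüttner equilibrium distribution with α = 1, computed in the rest frame where the future mass shell is parametrized by p ∈ ℝ^d with p⁰ = √(m² + ‖p‖²) and invariant volume element d^d p / p⁰, so that n = ∫ p⁰ f^{(0)} d^d p/p⁰.) -/

import Mathlib

open MeasureTheory Real Filter

/-- The modified Bessel function of the second kind, defined via its integral
representation `K_ν(z) = ∫_0^∞ exp(−z cosh t) cosh(ν t) dt`. -/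
noncomputable def besselK (ν z : ℝ) : ℝ :=
  ∫ t in Set.Ioi (0:ℝ), Real.exp (-z * Real.cosh t) * Real.cosh (ν * t)

/-- A continuous function dominated by some power of `cosh`. -/
structure PolyCoshBounded (f : ℝ → ℝ) : Prop where
  continuous : Continuous f
  bound : ∃ (N : ℕ) (A : ℝ), ∀ t, |f t| ≤ A * Real.cosh t ^ N

namespace PolyCoshBounded

lemma const (c : ℝ) : PolyCoshBounded fun _ => c :=
  ⟨continuous_const, 0, |c|, fun t => by simp⟩

lemma cosh : PolyCoshBounded Real.cosh :=
  ⟨Real.continuous_cosh, 1, 1, fun t => by simp [abs_of_pos (Real.cosh_pos t)]⟩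

lemma abs_sinh_le_cosh (t : ℝ) : |Real.sinh t| ≤ Real.cosh t := by
  rw [Real.abs_sinh, ← Real.cosh_abs]
  exact (Real.sinh_lt_cosh _).le

lemma sinh : PolyCoshBounded Real.sinh :=
  ⟨Real.continuous_sinh, 1, 1, fun t => by simpa using abs_sinh_le_cosh t⟩

lemma mul {f g : ℝ → ℝ} (hf : PolyCoshBounded f) (hg : PolyCoshBounded g) :
    PolyCoshBounded fun t => f t * g t := by
  obtain ⟨N, A, hA⟩ := hf.bound
  obtain ⟨M, B, hB⟩ := hg.bound
  refine ⟨hf.continuous.mul hg.continuous, N + M, A * B, fun t => ?_⟩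
  calc |f t * g t| = |f t| * |g t| := abs_mul _ _
    _ ≤ (A * Real.cosh t ^ N) * (B * Real.cosh t ^ M) :=
      mul_le_mul (hA t) (hB t) (abs_nonneg _) ((abs_nonneg _).trans (hA t))
    _ = A * B * Real.cosh t ^ (N + M) := by ring

lemma add {f g : ℝ → ℝ} (hf : PolyCoshBounded f) (hg : PolyCoshBounded g) :
    PolyCoshBounded fun t => f t + g t := by
  obtain ⟨N, A, hA⟩ := hf.bound
  obtain ⟨M, B, hB⟩ := hg.bound
  refine ⟨hf.continuous.add hg.continuous, N + M, A + B, fun t => ?_⟩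
  have h0 := Real.cosh_pos t
  have hf0 : 0 ≤ A * Real.cosh t ^ N := (abs_nonneg _).trans (hA t)
  have hg0 : 0 ≤ B * Real.cosh t ^ M := (abs_nonneg _).trans (hB t)
  calc |f t + g t| ≤ |f t| + |g t| := abs_add_le _ _
    _ ≤ A * Real.cosh t ^ N + B * Real.cosh t ^ M := add_le_add (hA t) (hB t)
    _ ≤ A * Real.cosh t ^ N * Real.cosh t ^ M + B * Real.cosh t ^ M * Real.cosh t ^ N :=
      add_le_add (le_mul_of_one_le_right hf0 (one_le_pow₀ (Real.one_le_cosh t)))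
        (le_mul_of_one_le_right hg0 (one_le_pow₀ (Real.one_le_cosh t)))
    _ = (A + B) * Real.cosh t ^ (N + M) := by ring

lemma pow {f : ℝ → ℝ} (hf : PolyCoshBounded f) (n : ℕ) : PolyCoshBounded fun t => f t ^ n := by
  induction n with
  | zero => simpa using const 1
  | succ n ih => simpa [pow_succ] using ih.mul hf

lemma exp_abs_le_two_mul_cosh (t : ℝ) : Real.exp |t| ≤ 2 * Real.cosh t := by
  rw [← Real.cosh_abs, Real.cosh_eq]
  linarith [Real.exp_pos (-|t|)]

lemma cosh_mul_le (ν t : ℝ) : Real.cosh (ν * t) ≤ 2 ^ ⌈|ν|⌉₊ * Real.cosh t ^ ⌈|ν|⌉₊ := by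
  have h1 : Real.cosh (ν * t) ≤ Real.exp |ν * t| := by
    rw [← Real.cosh_abs, Real.cosh_eq]
    have : Real.exp (-|ν * t|) ≤ Real.exp |ν * t| :=
      Real.exp_le_exp.2 (by linarith [abs_nonneg (ν * t)])
    linarith
  have h2 : |ν * t| ≤ ⌈|ν|⌉₊ * |t| := by
    rw [abs_mul]
    exact mul_le_mul_of_nonneg_right (Nat.le_ceil _) (abs_nonneg t)
  calc Real.cosh (ν * t) ≤ Real.exp (⌈|ν|⌉₊ * |t|) := h1.trans (Real.exp_le_exp.2 h2)
    _ = Real.exp |t| ^ ⌈|ν|⌉₊ := Real.exp_nat_mul _ _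
    _ ≤ (2 * Real.cosh t) ^ ⌈|ν|⌉₊ := by
      gcongr
      exact exp_abs_le_two_mul_cosh t
    _ = _ := mul_pow _ _ _

lemma cosh_mul (ν : ℝ) : PolyCoshBounded fun t => Real.cosh (ν * t) :=
  ⟨by fun_prop, _, _, fun t => by
    rw [abs_of_pos (Real.cosh_pos _)]
    exact cosh_mul_le ν t⟩

lemma sinh_mul (ν : ℝ) : PolyCoshBounded fun t => Real.sinh (ν * t) :=
  ⟨by fun_prop, _, _, fun t => (abs_sinh_le_cosh _).trans (cosh_mul_le ν t)⟩

variable {f : ℝ → ℝ} {z : ℝ}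

lemma tendsto_cosh_atTop : Tendsto Real.cosh atTop atTop := by
  refine tendsto_atTop_mono (f := fun t : ℝ => Real.exp t / 2) (fun t => ?_)
    (Real.tendsto_exp_atTop.atTop_div_const two_pos)
  rw [Real.cosh_eq]
  linarith [Real.exp_pos (-t)]

lemma tendsto_exp_mul (hf : PolyCoshBounded f) (hz : 0 < z) :
    Tendsto (fun t => Real.exp (-z * Real.cosh t) * f t) atTop (nhds 0) := by
  obtain ⟨N, A, hA⟩ := hf.bound
  have h := ((Real.tendsto_pow_mul_exp_neg_atTop_nhds_zero N).comp
    (tendsto_cosh_atTop.const_mul_atTop hz)).const_mul (A / z ^ N)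
  rw [mul_zero] at h
  refine squeeze_zero_norm (fun t => ?_) h
  rw [Real.norm_eq_abs, abs_mul, abs_of_pos (Real.exp_pos _)]
  calc Real.exp (-z * Real.cosh t) * |f t|
      ≤ Real.exp (-z * Real.cosh t) * (A * Real.cosh t ^ N) := by
        gcongr
        exact hA t
    _ = _ := by
      simp only [Function.comp_apply, mul_pow, neg_mul]
      field_simp

lemma integrableOn_exp_mul (hf : PolyCoshBounded f) (hz : 0 < z) :
    IntegrableOn (fun t => Real.exp (-z * Real.cosh t) * f t) (Set.Ioi 0) := by
  have hc := hf.continuous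
  refine integrable_of_isBigO_exp_neg one_pos (by fun_prop) ?_
  have h := ((hf.mul ((const 2).mul cosh)).tendsto_exp_mul hz).isBigO_one ℝ
  have h' := h.mul (Asymptotics.isBigO_refl (fun t : ℝ => Real.exp (-1 * t)) atTop)
  simp only [one_mul] at h'
  refine Asymptotics.IsBigO.trans (Asymptotics.isBigO_of_le _ fun t => ?_) h'
  have h1 : 1 ≤ 2 * Real.cosh t * Real.exp (-1 * t) := by
    have := (Real.exp_le_exp.2 (le_abs_self t)).trans (exp_abs_le_two_mul_cosh t)
    calc (1 : ℝ) = Real.exp t * Real.exp (-1 * t) := by rw [← Real.exp_add]; simp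
      _ ≤ _ := by gcongr
  rw [Real.norm_eq_abs, Real.norm_eq_abs]
  calc |Real.exp (-z * Real.cosh t) * f t|
      ≤ |Real.exp (-z * Real.cosh t) * f t| * (2 * Real.cosh t * Real.exp (-1 * t)) :=
        le_mul_of_one_le_right (abs_nonneg _) h1
    _ = |Real.exp (-z * Real.cosh t) * f t| * |2 * Real.cosh t * Real.exp (-1 * t)| := by
        rw [abs_of_pos (zero_lt_one.trans_le h1)]
    _ = |Real.exp (-z * Real.cosh t) * (f t * (2 * Real.cosh t)) * Real.exp (-1 * t)| := by
        rw [← abs_mul]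
        ring_nf

/-- Integration by parts against `sinh t * exp (-z * cosh t)`. -/
lemma integral_exp_mul_mul_sinh {f' : ℝ → ℝ} (hf : PolyCoshBounded f) (hf' : PolyCoshBounded f')
    (hd : ∀ t, HasDerivAt f (f' t) t) (hz : 0 < z) :
    z * ∫ t in Set.Ioi (0:ℝ), Real.exp (-z * Real.cosh t) * (f t * Real.sinh t)
      = f 0 * Real.exp (-z) + ∫ t in Set.Ioi (0:ℝ), Real.exp (-z * Real.cosh t) * f' t := by
  have i1 := hf'.integrableOn_exp_mul hz
  have i2 := ((hf.mul sinh).integrableOn_exp_mul hz).const_mul z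
  have key := integral_Ioi_of_hasDerivAt_of_tendsto' (a := 0)
    (f := fun t => Real.exp (-z * Real.cosh t) * f t)
    (f' := fun t => Real.exp (-z * Real.cosh t) * f' t -
      z * (Real.exp (-z * Real.cosh t) * (f t * Real.sinh t)))
    (fun t _ => ?_) (i1.sub i2) (hf.tendsto_exp_mul hz)
  · rw [integral_sub i1 i2, integral_const_mul] at key
    simp only [Real.cosh_zero, mul_one] at key
    linarith
  · convert! (((Real.hasDerivAt_cosh t).const_mul (-z)).exp.mul (hd t)) using 1
    ring

end PolyCoshBounded

lemma besselK_neg (ν z : ℝ) : besselK (-ν) z = besselK ν z := by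
  simp [besselK]

lemma besselK_add_one {z : ℝ} (hz : 0 < z) (ν : ℝ) :
    besselK (ν + 1) z = besselK (ν - 1) z + 2 * ν / z * besselK ν z := by
  have h := (PolyCoshBounded.sinh_mul ν).integral_exp_mul_mul_sinh
    ((PolyCoshBounded.const ν).mul (PolyCoshBounded.cosh_mul ν))
    (fun t => by
      convert! ((hasDerivAt_id t).const_mul ν).sinh using 1
      simp [mul_comm]) hz
  have h2 : besselK (ν + 1) z - besselK (ν - 1) z =
      2 * ∫ t in Set.Ioi (0:ℝ),
        Real.exp (-z * Real.cosh t) * (Real.sinh (ν * t) * Real.sinh t) := by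
    unfold besselK
    rw [← integral_sub ((PolyCoshBounded.cosh_mul _).integrableOn_exp_mul hz)
      ((PolyCoshBounded.cosh_mul _).integrableOn_exp_mul hz), ← integral_const_mul]
    congr 1 with t
    rw [add_mul, sub_mul, one_mul, Real.cosh_add, Real.cosh_sub]
    ring
  have h3 : ∫ t in Set.Ioi (0:ℝ), Real.exp (-z * Real.cosh t) * (ν * Real.cosh (ν * t)) =
      ν * besselK ν z := by
    unfold besselK
    rw [← integral_const_mul]
    congr 1 with t
    ring
  rw [h3] at h
  simp only [mul_zero, Real.sinh_zero, zero_mul, zero_add] at h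
  rw [← sub_eq_iff_eq_add', h2, div_mul_eq_mul_div, eq_div_iff hz.ne']
  linarith

/-- The substitution `y = a * sinh (b * t)` on the half-line. -/
lemma integral_Ioi_comp_mul_sinh {a b : ℝ} (ha : 0 < a) (hb : 0 < b) (g : ℝ → ℝ) :
    ∫ y in Set.Ioi (0:ℝ), g y
      = ∫ t in Set.Ioi (0:ℝ), a * b * Real.cosh (b * t) * g (a * Real.sinh (b * t)) := by
  have himage : (fun t => a * Real.sinh (b * t)) '' Set.Ioi 0 = Set.Ioi 0 := by
    ext y
    simp only [Set.mem_image, Set.mem_Ioi]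
    constructor
    · rintro ⟨t, ht, rfl⟩
      exact mul_pos ha (Real.sinh_pos_iff.2 (mul_pos hb ht))
    · intro hy
      refine ⟨Real.arsinh (y / a) / b, div_pos (Real.arsinh_pos_iff.2 (div_pos hy ha)) hb, ?_⟩
      rw [mul_div_cancel₀ _ hb.ne', Real.sinh_arsinh, mul_div_cancel₀ _ ha.ne']
  have h := integral_image_eq_integral_deriv_smul_of_monotoneOn (s := Set.Ioi (0:ℝ))
    (f := fun t => a * Real.sinh (b * t)) (f' := fun t => a * b * Real.cosh (b * t))
    measurableSet_Ioi
    (fun t _ => by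
      have := (((hasDerivAt_id t).const_mul b).sinh).const_mul a
      convert! this.hasDerivWithinAt using 1
      simp
      ring)
    (fun s _ t _ hst => by
      have : Real.sinh (b * s) ≤ Real.sinh (b * t) := Real.sinh_le_sinh.2 (by gcongr)
      dsimp only
      gcongr) g
  rw [himage] at h
  simpa using h

lemma besselK_one_half (z : ℝ) :
    besselK (1 / 2) z = Real.exp (-z) * √(π / (2 * z)) := by
  have h := integral_gaussian_Ioi (2 * z)
  rw [integral_Ioi_comp_mul_sinh one_pos (one_half_pos (α := ℝ))] at h
  have h2 : besselK (1 / 2) z = 2 * Real.exp (-z) * ∫ t in Set.Ioi (0:ℝ),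
      1 * (1 / 2) * Real.cosh (1 / 2 * t) *
        Real.exp (-(2 * z) * (1 * Real.sinh (1 / 2 * t)) ^ 2) := by
    unfold besselK
    rw [← integral_const_mul]
    congr 1 with t
    have hc : Real.cosh t = 1 + 2 * Real.sinh (1 / 2 * t) ^ 2 := by
      have h1 := Real.cosh_two_mul (1 / 2 * t)
      rw [Real.cosh_sq] at h1
      rw [show t = 2 * (1 / 2 * t) by ring, h1]
      ring_nf
    rw [hc, show -z * (1 + 2 * Real.sinh (1 / 2 * t) ^ 2) =
      -z + -(2 * z) * (1 * Real.sinh (1 / 2 * t)) ^ 2 by ring, Real.exp_add]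
    ring
  rw [h2, h]
  ring

/-- Poisson's integral representation of `besselK` at half-integer multiples, together with
the companion formula obtained from it by differentiation in `z`. -/
lemma integral_exp_mul_sinh_pow {z : ℝ} (hz : 0 < z) (n : ℕ) :
    (∫ t in Set.Ioi (0:ℝ), Real.exp (-z * Real.cosh t) * Real.sinh t ^ n
      = (2 / z) ^ ((n : ℝ) / 2) * Real.Gamma (((n : ℝ) + 1) / 2) / √π * besselK ((n : ℝ) / 2) z) ∧
    (∫ t in Set.Ioi (0:ℝ), Real.exp (-z * Real.cosh t) * (Real.sinh t ^ n * Real.cosh t)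
      = (2 / z) ^ ((n : ℝ) / 2) * Real.Gamma (((n : ℝ) + 1) / 2) / √π *
        besselK ((n : ℝ) / 2 + 1) z) := by
  have hpi : √π ≠ 0 := (Real.sqrt_pos.2 Real.pi_pos).ne'
  induction n using Nat.twoStepInduction with
  | zero =>
    have hG : Real.Gamma 2⁻¹ = √π := by rw [← one_div, Real.Gamma_one_half_eq]
    simp [besselK, hG, hpi]
  | one =>
    have hJ := (PolyCoshBounded.const 1).integral_exp_mul_mul_sinh (PolyCoshBounded.const 0)
      (fun t => hasDerivAt_const t 1) hz
    have hC := PolyCoshBounded.cosh.integral_exp_mul_mul_sinh PolyCoshBounded.sinh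
      (fun t => Real.hasDerivAt_cosh t) hz
    simp only [one_mul, mul_zero, integral_zero, add_zero, Real.cosh_zero] at hJ hC
    have hK : (2 / z) ^ ((1 : ℝ) / 2) * Real.Gamma ((1 + 1) / 2) / √π * besselK (1 / 2) z =
        Real.exp (-z) / z := by
      have h1 : √(2 / z) * √(π / (2 * z)) = √π / z := by
        rw [← Real.sqrt_mul (by positivity), show 2 / z * (π / (2 * z)) = π / z ^ 2 by field_simp,
          Real.sqrt_div Real.pi_pos.le, Real.sqrt_sq hz.le]
      rw [← Real.sqrt_eq_rpow, besselK_one_half z, show ((1 : ℝ) + 1) / 2 = 1 by norm_num,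
        Real.Gamma_one]
      calc _ = (√(2 / z) * √(π / (2 * z))) * Real.exp (-z) / √π := by ring
        _ = _ := by rw [h1]; field_simp
    have hK' : besselK (1 / 2 + 1) z = (1 + 1 / z) * besselK (1 / 2) z := by
      rw [besselK_add_one hz, show (1 / 2 - 1 : ℝ) = -(1 / 2) by norm_num, besselK_neg]
      ring
    have hJ' : ∫ t in Set.Ioi (0:ℝ), Real.exp (-z * Real.cosh t) * Real.sinh t =
        Real.exp (-z) / z := by
      rw [eq_div_iff hz.ne', mul_comm, hJ]
    simp only [pow_one, Nat.cast_one]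
    refine ⟨by rw [hK, hJ'], ?_⟩
    rw [hK', mul_left_comm, hK]
    simp only [mul_comm (Real.sinh _) (Real.cosh _)]
    rw [hJ'] at hC
    apply mul_left_cancel₀ hz.ne'
    rw [hC]
    field_simp
  | more n ih _ =>
    obtain ⟨hJ, hC⟩ := ih
    set J := ∫ t in Set.Ioi (0:ℝ), Real.exp (-z * Real.cosh t) * Real.sinh t ^ n with hJdef
    set C := ∫ t in Set.Ioi (0:ℝ), Real.exp (-z * Real.cosh t) * (Real.sinh t ^ n * Real.cosh t)
      with hCdef
    have hJ2 : z * ∫ t in Set.Ioi (0:ℝ), Real.exp (-z * Real.cosh t) * Real.sinh t ^ (n + 2) =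
        (n + 1) * C := by
      have h := (PolyCoshBounded.sinh.pow (n + 1)).integral_exp_mul_mul_sinh (z := z)
        (f' := fun t => (n + 1) * (Real.sinh t ^ n * Real.cosh t))
        ((PolyCoshBounded.const _).mul ((PolyCoshBounded.sinh.pow n).mul PolyCoshBounded.cosh))
        (fun t => by
          convert! (Real.hasDerivAt_sinh t).pow (n + 1) using 1
          push_cast
          ring) hz
      rw [hCdef, ← integral_const_mul ((n : ℝ) + 1)]
      simp only [Real.sinh_zero, ne_eq, Nat.succ_ne_zero, not_false_eq_true, zero_pow, zero_mul,
        zero_add, ← pow_succ] at h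
      rw [h]
      congr 1 with t
      ring
    have hC2 : z * ∫ t in Set.Ioi (0:ℝ),
        Real.exp (-z * Real.cosh t) * (Real.sinh t ^ (n + 2) * Real.cosh t) =
        (n + 2) * (∫ t in Set.Ioi (0:ℝ), Real.exp (-z * Real.cosh t) * Real.sinh t ^ (n + 2)) +
          (n + 1) * J := by
      have h := ((PolyCoshBounded.sinh.pow (n + 1)).mul
          PolyCoshBounded.cosh).integral_exp_mul_mul_sinh (z := z)
        (f' := fun t => (n + 1) * (Real.sinh t ^ n * Real.cosh t) * Real.cosh t +
          Real.sinh t ^ (n + 1) * Real.sinh t)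
        (((PolyCoshBounded.const _).mul ((PolyCoshBounded.sinh.pow n).mul
          PolyCoshBounded.cosh)).mul PolyCoshBounded.cosh |>.add
          ((PolyCoshBounded.sinh.pow (n + 1)).mul PolyCoshBounded.sinh)) (fun t => ?_) hz
      · rw [hJdef, ← integral_const_mul ((n : ℝ) + 2), ← integral_const_mul ((n : ℝ) + 1), ← integral_add
          (((PolyCoshBounded.sinh.pow _).integrableOn_exp_mul hz).const_mul _)
          (((PolyCoshBounded.sinh.pow _).integrableOn_exp_mul hz).const_mul _)]
        simp only [Real.sinh_zero, ne_eq, Nat.succ_ne_zero, not_false_eq_true, zero_pow, zero_mul,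
          zero_add] at h
        calc _ = _ := by
              congr 2 with t
              ring
          _ = _ := h
          _ = _ := by
              congr 1 with t
              have := Real.cosh_sq t
              linear_combination Real.exp (-z * Real.cosh t) * (n + 1) * Real.sinh t ^ n * this
      · convert! ((Real.hasDerivAt_sinh t).pow (n + 1)).mul (Real.hasDerivAt_cosh t) using 1
        simp only [add_tsub_cancel_right, Pi.pow_apply]
        push_cast
        ring
    have hG : Real.Gamma (((n : ℝ) + 2 + 1) / 2) =
        ((n : ℝ) + 1) / 2 * Real.Gamma (((n : ℝ) + 1) / 2) := by
      rw [← Real.Gamma_add_one (by positivity)]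
      ring_nf
    have hp : (2 / z) ^ (((n : ℝ) + 2) / 2) = (2 / z) ^ ((n : ℝ) / 2) * (2 / z) := by
      rw [add_div, div_self two_ne_zero, Real.rpow_add_one (by positivity)]
    have hrec : besselK ((n : ℝ) / 2 + 1 + 1) z =
        besselK ((n : ℝ) / 2) z + (n + 2) / z * besselK ((n : ℝ) / 2 + 1) z := by
      rw [besselK_add_one hz]
      ring_nf
    push_cast
    rw [hG, hp, show ((n : ℝ) + 2) / 2 = n / 2 + 1 by ring, hrec]
    rw [hC] at hJ2
    rw [hJ] at hC2
    have hJ2' : ∫ t in Set.Ioi (0:ℝ), Real.exp (-z * Real.cosh t) * Real.sinh t ^ (n + 2) =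
        (2 / z) ^ ((n : ℝ) / 2) * (2 / z) * ((n + 1) / 2 * Real.Gamma (((n : ℝ) + 1) / 2)) / √π *
          besselK ((n : ℝ) / 2 + 1) z := by
      apply mul_left_cancel₀ hz.ne'
      rw [hJ2]
      field_simp
    refine ⟨hJ2', ?_⟩
    apply mul_left_cancel₀ hz.ne'
    rw [hC2, hJ2']
    field_simp
    ring

/-- The particle density `n` of the Jüttner distribution (with `α = 1`), computed in
the rest frame: `∫_{ℝ^d} exp(−(z/m)√(m²+‖p‖²)) dp = 2m (2π m²/z)^{(d−1)/2} K_{(d+1)/2}(z)`. -/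
theorem juttner_particle_density (d : ℕ) (hd : 2 ≤ d) (m z : ℝ)
    (hm : 0 < m) (hz : 0 < z) :
    (∫ p : EuclideanSpace ℝ (Fin d),
        Real.exp (-(z / m) * Real.sqrt (m ^ 2 + ‖p‖ ^ 2)))
      = 2 * m * (2 * Real.pi * m ^ 2 / z) ^ (((d : ℝ) - 1) / 2)
          * besselK (((d : ℝ) + 1) / 2) z := by
  obtain ⟨n, rfl⟩ : ∃ n, d = n + 1 := ⟨d - 1, by omega⟩
  rw [integral_fun_norm_addHaar (volume : Measure (EuclideanSpace ℝ (Fin (n + 1))))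
    (fun y => Real.exp (-(z / m) * Real.sqrt (m ^ 2 + y ^ 2))), finrank_euclideanSpace_fin]
  have hball : volume.real (Metric.ball (0 : EuclideanSpace ℝ (Fin (n + 1))) 1) =
      √π ^ (n + 1) / Real.Gamma (((n : ℝ) + 1) / 2 + 1) := by
    have hG : 0 < Real.Gamma (((n : ℝ) + 1) / 2 + 1) := Real.Gamma_pos_of_pos (by positivity)
    rw [Measure.real, EuclideanSpace.volume_ball]
    simp only [ENNReal.ofReal_one, one_pow, one_mul, Fintype.card_fin, Nat.cast_add, Nat.cast_one]
    exact ENNReal.toReal_ofReal (by positivity)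
  have hradial : ∫ y in Set.Ioi (0:ℝ), y ^ n * Real.exp (-(z / m) * Real.sqrt (m ^ 2 + y ^ 2)) =
      m ^ (n + 1) *
        ∫ t in Set.Ioi (0:ℝ), Real.exp (-z * Real.cosh t) * (Real.sinh t ^ n * Real.cosh t) := by
    rw [integral_Ioi_comp_mul_sinh hm one_pos, ← integral_const_mul]
    congr 1 with t
    have hs : √(m ^ 2 + (m * Real.sinh t) ^ 2) = m * Real.cosh t := by
      rw [show m ^ 2 + (m * Real.sinh t) ^ 2 = (m * Real.cosh t) ^ 2 by
        rw [mul_pow, mul_pow, Real.cosh_sq]; ring]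
      exact Real.sqrt_sq (mul_pos hm (Real.cosh_pos t)).le
    rw [one_mul, hs, show -(z / m) * (m * Real.cosh t) = -z * Real.cosh t by field_simp]
    ring
  have hpow : (2 * π * m ^ 2 / z) ^ ((n : ℝ) / 2) = (2 / z) ^ ((n : ℝ) / 2) * √π ^ n * m ^ n := by
    have hsq : ∀ x : ℝ, 0 ≤ x → (x ^ 2) ^ ((n : ℝ) / 2) = x ^ n := fun x hx => by
      rw [← Real.rpow_natCast x 2, ← Real.rpow_mul hx, ← Real.rpow_natCast x n]
      congr 1
      push_cast
      ring
    rw [← hsq m hm.le, ← hsq (√π) (Real.sqrt_nonneg _), Real.sq_sqrt Real.pi_pos.le,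
      ← Real.mul_rpow (by positivity) (by positivity),
      ← Real.mul_rpow (by positivity) (by positivity)]
    congr 1
    ring
  simp only [add_tsub_cancel_right, smul_eq_mul, nsmul_eq_mul]
  rw [hball, hradial, (integral_exp_mul_sinh_pow hz n).2]
  push_cast
  rw [add_sub_cancel_right, hpow, Real.Gamma_add_one (by positivity),
    show ((n : ℝ) + 1 + 1) / 2 = n / 2 + 1 by ring]
  have hG : Real.Gamma (((n : ℝ) + 1) / 2) ≠ 0 := (Real.Gamma_pos_of_pos (by positivity)).ne'
  field_simp
  ring
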